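/- arXiv:1401.6040 — 2 statements merged into one kernel-verified Lean document; each statement's English description precedes it below -/
import Mathlib

section
/- Let f be an isoarithmetic IASI with common difference d of a finite simple graph G, and let S(G) be the full subdivision of G: its vertex set is the disjoint union V(G) ⊔ E(G), with v ∈ V(G) adjacent to e ∈ E(G) iff v is an endpoint of e, and no other adjacencies. Label each v ∈ V(G) by f(v) and each e ∈ E(G) by f⁺(e). Then every vertex label and every edge label of S(G) under this labeling is a d-AP-set. -/
open Pointwise

/-- A finite set of naturals is a `d`-AP-set if `d > 0`, it has at least 3 elements,
and its elements form an arithmetic progression with common difference `d`. -/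
def IsAPSet (d : ℕ) (A : Finset ℕ) : Prop :=
  0 < d ∧ 3 ≤ A.card ∧ ∃ a : ℕ, A = (Finset.range A.card).image (fun i => a + i * d)

/-- An integer additive set-indexer (IASI) of a simple graph `G`: an injective labeling of
vertices by nonempty finite sets of naturals whose induced edge labeling
`f⁺(uv) = f(u) + f(v)` (sumset) is injective on edges. -/
structure IsIASI {V : Type*} (G : SimpleGraph V) (f : V → Finset ℕ) : Prop where
  injective : Function.Injective f
  nonempty : ∀ v, (f v).Nonempty
  edgeInjective : ∀ ⦃u v x y : V⦄, G.Adj u v → G.Adj x y →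
    f u + f v = f x + f y → s(u, v) = s(x, y)

/-- An isoarithmetic IASI of `G` with common difference `d`: an IASI all of whose vertex
and edge labels are `d`-AP-sets. -/
def IsIsoarithmeticIASI {V : Type*} (G : SimpleGraph V) (f : V → Finset ℕ) (d : ℕ) : Prop :=
  IsIASI G f ∧ (∀ v, IsAPSet d (f v)) ∧ (∀ u v, G.Adj u v → IsAPSet d (f u + f v))

theorem card_image_range_add_mul {d : ℕ} (hd : 0 < d) (a n : ℕ) :
    ((Finset.range n).image (fun i => a + i * d)).card = n := by
  rw [Finset.card_image_of_injective, Finset.card_range]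
  intro i j hij
  exact Nat.eq_of_mul_eq_mul_right hd (Nat.add_left_cancel hij)

theorem image_range_add_image_range {d a b m n : ℕ} (hm : 0 < m) (hn : 0 < n) :
    (Finset.range m).image (fun i => a + i * d) + (Finset.range n).image (fun i => b + i * d) =
      (Finset.range (m + n - 1)).image (fun i => (a + b) + i * d) := by
  ext x
  simp only [Finset.mem_add, Finset.mem_image, Finset.mem_range]
  constructor
  · rintro ⟨_, ⟨i, hi, rfl⟩, _, ⟨j, hj, rfl⟩, rfl⟩
    exact ⟨i + j, by omega, by ring⟩
  · rintro ⟨k, hk, rfl⟩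
    obtain ⟨i, j, hi, hj, rfl⟩ : ∃ i j, i < m ∧ j < n ∧ k = i + j :=
      ⟨min k (m - 1), k - min k (m - 1), by omega, by omega, by omega⟩
    exact ⟨_, ⟨i, hi, rfl⟩, _, ⟨j, hj, rfl⟩, by ring⟩

theorem IsAPSet.add {d : ℕ} {A B : Finset ℕ} (hA : IsAPSet d A) (hB : IsAPSet d B) :
    IsAPSet d (A + B) := by
  obtain ⟨hd, hA3, a, ha⟩ := hA
  obtain ⟨-, hB3, b, hb⟩ := hB
  have hAB : A + B =
      (Finset.range (A.card + B.card - 1)).image (fun i => (a + b) + i * d) := by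
    rw [← image_range_add_image_range (by omega) (by omega), ← ha, ← hb]
  have hcard : (A + B).card = A.card + B.card - 1 := by
    rw [hAB, card_image_range_add_mul hd]
  exact ⟨hd, by omega, a + b, by rw [hcard, hAB]⟩

/-- In the full subdivision `S(G)` of an isoarithmetic IASI graph `G`, labeling the
original vertices by their `f`-labels and the subdivision vertices (edges of `G`) by the
corresponding edge labels `f⁺(e)`, every vertex label and every edge label (a vertex `v`
joined to an edge `e = xy` having `v ∈ {x, y}`) is a `d`-AP-set. -/
theorem stmt6 {V : Type*} [Fintype V] (G : SimpleGraph V)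
    (f : V → Finset ℕ) (d : ℕ) (h : IsIsoarithmeticIASI G f d) :
    (∀ v, IsAPSet d (f v)) ∧
    (∀ x y, G.Adj x y → IsAPSet d (f x + f y)) ∧
    (∀ v x y, G.Adj x y → (v = x ∨ v = y) → IsAPSet d (f v + (f x + f y))) := by
  obtain ⟨-, hv, he⟩ := h
  exact ⟨hv, he, fun v x y hxy _ => (hv v).add (he x y hxy)⟩
end

section
/- Let f be a biarithmetic IASI of a finite simple graph G and let e = uv be an edge of G with deterministic indices d_u ≤ d_v. Form the subdivision of G at e: remove the edge uv and add a new vertex w adjacent exactly to u and v; extend f by labeling w with f⁺(e) = f(u)+f(v). Then f⁺(e) is a d_u-AP-set, so the adjacent vertices u and w carry AP-set labels with the same deterministic index d_u; hence the extended labeling violates the biarithmetic condition at the edge uw (there is no integer k' > 1 with one deterministic index equal to k' times the other), and therefore is not a biarithmetic labeling of the subdivided graph. -/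
open Pointwise

/-- A biarithmetic IASI of `G`: an IASI whose vertex labels are AP-sets with deterministic
indices `dv`, whose edge labels are AP-sets, and such that on each edge one deterministic
index is `k` times the other for some integer `k > 1` with `k` at most the cardinality of
the label of the vertex with the smaller index. -/
def IsBiarithmeticIASI {V : Type*} (G : SimpleGraph V) (f : V → Finset ℕ)
    (dv : V → ℕ) : Prop :=
  IsIASI G f ∧ (∀ v, IsAPSet (dv v) (f v)) ∧
    (∀ u v, G.Adj u v → ∃ δ, IsAPSet δ (f u + f v)) ∧
    (∀ u v, G.Adj u v → ∃ k : ℕ, 1 < k ∧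
      ((dv v = k * dv u ∧ k ≤ (f u).card) ∨ (dv u = k * dv v ∧ k ≤ (f v).card)))

theorem isAPSet_image_range {d n : ℕ} (hd : 0 < d) (hn : 3 ≤ n) (a : ℕ) :
    IsAPSet d ((Finset.range n).image (fun i => a + i * d)) := by
  have hcard : ((Finset.range n).image (fun i => a + i * d)).card = n := by
    rw [Finset.card_image_of_injective, Finset.card_range]
    intro i j hij
    exact Nat.eq_of_mul_eq_mul_right hd (Nat.add_left_cancel hij)
  exact ⟨hd, hcard.symm ▸ hn, a, by rw [hcard]⟩

theorem IsAPSet.exists_mem_iff {d : ℕ} {A : Finset ℕ} (h : IsAPSet d A) :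
    ∃ a, ∀ x, x ∈ A ↔ ∃ i < A.card, a + i * d = x := by
  obtain ⟨-, -, a, ha⟩ := h
  refine ⟨a, fun x => ?_⟩
  conv_lhs => rw [ha]
  simp

/-- The deterministic index of an AP-set is unique. -/
theorem IsAPSet.index_unique {d e : ℕ} {A : Finset ℕ} (hd : IsAPSet d A) (he : IsAPSet e A) :
    d = e := by
  obtain ⟨a, ha⟩ := hd.exists_mem_iff
  obtain ⟨b, hb⟩ := he.exists_mem_iff
  have hcard := hd.2.1
  have hd0 := hd.1
  have he0 := he.1
  obtain ⟨i, -, hi⟩ := (hb a).1 ((ha a).2 ⟨0, by omega, by simp⟩)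
  obtain ⟨j, -, hj⟩ := (ha b).1 ((hb b).2 ⟨0, by omega, by simp⟩)
  obtain rfl : a = b := by omega
  obtain ⟨p, -, hp⟩ := (hb (a + d)).1 ((ha _).2 ⟨1, by omega, by simp⟩)
  obtain ⟨q, -, hq⟩ := (ha (a + e)).1 ((hb _).2 ⟨1, by omega, by simp⟩)
  have hed : e ∣ d := ⟨p, by rw [mul_comm]; omega⟩
  have hde : d ∣ e := ⟨q, by rw [mul_comm]; omega⟩
  exact Nat.dvd_antisymm hde hed

/-- The sum of a `d`-AP-set `A` and a `k * d`-AP-set is a `d`-AP-set when `0 < k ≤ |A|`. -/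
theorem IsAPSet.add_of_le_card {d k : ℕ} {A B : Finset ℕ} (hA : IsAPSet d A)
    (hB : IsAPSet (k * d) B) (hk : 0 < k) (hkA : k ≤ A.card) : IsAPSet d (A + B) := by
  obtain ⟨a, ha⟩ := hA.exists_mem_iff
  obtain ⟨b, hb⟩ := hB.exists_mem_iff
  have hA3 := hA.2.1
  have hB3 := hB.2.1
  obtain ⟨l, hl⟩ : ∃ l, B.card = l + 1 := ⟨B.card - 1, by omega⟩
  suffices hAB : A + B =
      (Finset.range (A.card + l * k)).image (fun i => a + b + i * d) by
    rw [hAB]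
    exact isAPSet_image_range hA.1 (by omega) _
  ext x
  simp only [Finset.mem_add, ha, hb, Finset.mem_image, Finset.mem_range]
  constructor
  · rintro ⟨_, ⟨i, hi, rfl⟩, _, ⟨j, hj, rfl⟩, rfl⟩
    have hjl : j * k ≤ l * k := Nat.mul_le_mul_right k (by omega)
    exact ⟨i + j * k, by omega, by ring⟩
  · rintro ⟨t, ht, rfl⟩
    obtain ⟨i, j, hi, hj, rfl⟩ : ∃ i j, i < A.card ∧ j < B.card ∧ t = i + j * k := by
      by_cases htl : t < l * k
      · have hdiv : t / k < l := Nat.div_lt_of_lt_mul (by rwa [mul_comm])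
        have hmod : t % k < k := Nat.mod_lt t hk
        exact ⟨t % k, t / k, by omega, by omega, by rw [mul_comm, Nat.mod_add_div]⟩
      · exact ⟨t - l * k, l, by omega, by omega, by omega⟩
    exact ⟨_, ⟨i, hi, rfl⟩, _, ⟨j, hj, rfl⟩, by ring⟩

/-- Subdividing an edge `uv` (with `d_u ≤ d_v`) of a biarithmetic IASI graph and labeling
the new vertex `w` by `f⁺(uv)`: the label `f⁺(uv)` is a `d_u`-AP-set, and at the new edge
`uw` the biarithmetic condition fails, i.e. for the deterministic index `δ` of the label
of `w` there is no integer `k' > 1` with `δ = k' · d_u` or `d_u = k' · δ`. -/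
theorem stmt19 {V : Type*} [Fintype V] (G : SimpleGraph V)
    (f : V → Finset ℕ) (dv : V → ℕ) (h : IsBiarithmeticIASI G f dv)
    (u v : V) (huv : G.Adj u v) (hle : dv u ≤ dv v) :
    IsAPSet (dv u) (f u + f v) ∧
    ∀ δ, IsAPSet δ (f u + f v) →
      ¬ ∃ k' : ℕ, 1 < k' ∧ (δ = k' * dv u ∨ dv u = k' * δ) := by
  obtain ⟨-, hAP, -, hdet⟩ := h
  have hu := hAP u
  have hv := hAP v
  have hsum : IsAPSet (dv u) (f u + f v) := by
    obtain ⟨k, hk, ⟨hkd, hkcard⟩ | ⟨hkd, -⟩⟩ := hdet u v huv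
    · exact hu.add_of_le_card (hkd ▸ hv) (by omega) hkcard
    · have := hv.1
      nlinarith
  refine ⟨hsum, fun δ hδ => ?_⟩
  obtain rfl := hδ.index_unique hsum
  rintro ⟨k, hk, hkd | hkd⟩ <;> nlinarith [hδ.1]
end
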